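/- arXiv:0809.5147 — 7 statements merged into one kernel-verified Lean document; each statement's English description precedes it below -/
import Mathlib

section
/- Let s ∈ ℝ³, let T be a 3×3 real symmetric matrix, and let O be a 3×3 real orthogonal matrix with det O = 1. Set s' = O s and T' = O T Oᵀ. Then each of the six symmetric two-qubit local invariants is unchanged: det T' = det T, Tr(T'²) = Tr(T²), s'ᵀs' = sᵀs, s'ᵀT's' = sᵀTs, I₅(s',T') = I₅(s,T), and I₆(s',T') = I₆(s,T). -/
open Matrix

/-- The Levi-Civita symbol on `Fin 3`. -/
noncomputable def eps (i j k : Fin 3) : ℝ :=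
  (((j : ℕ) : ℝ) - ((i : ℕ) : ℝ)) * (((k : ℕ) : ℝ) - ((i : ℕ) : ℝ)) *
    (((k : ℕ) : ℝ) - ((j : ℕ) : ℝ)) / 2

/-- The local invariant `I₅(s,T) = ε_{ijk} ε_{lmn} s_i s_l T_{jm} T_{kn}`. -/
noncomputable def I5 (s : Fin 3 → ℝ) (T : Matrix (Fin 3) (Fin 3) ℝ) : ℝ :=
  ∑ i, ∑ j, ∑ k, ∑ l, ∑ m, ∑ n,
    eps i j k * eps l m n * s i * s l * T j m * T k n

/-- The local invariant `I₆(s,T) = ε_{ijk} s_i (Ts)_j (T²s)_k`. -/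
noncomputable def I6 (s : Fin 3 → ℝ) (T : Matrix (Fin 3) (Fin 3) ℝ) : ℝ :=
  ∑ i, ∑ j, ∑ k, eps i j k * s i * (T.mulVec s) j * ((T * T).mulVec s) k

theorem I5_eq_adjugate (s : Fin 3 → ℝ) (T : Matrix (Fin 3) (Fin 3) ℝ) :
    I5 s T = 2 * (s ⬝ᵥ T.adjugate *ᵥ s) := by
  rw [adjugate_fin_three]
  simp [I5, eps, Fin.sum_univ_three, Matrix.mulVec, dotProduct]
  ring

theorem sum_eps_eq_det (u v w : Fin 3 → ℝ) :
    ∑ i, ∑ j, ∑ k, eps i j k * u i * v j * w k = (Matrix.of ![u, v, w]).det := by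
  rw [det_fin_three]
  simp [eps, Fin.sum_univ_three]
  ring

theorem det_of_mulVec (O : Matrix (Fin 3) (Fin 3) ℝ) (u v w : Fin 3 → ℝ) :
    (Matrix.of ![O *ᵥ u, O *ᵥ v, O *ᵥ w]).det = O.det * (Matrix.of ![u, v, w]).det := by
  have h : Matrix.of ![O *ᵥ u, O *ᵥ v, O *ᵥ w] = Matrix.of ![u, v, w] * Oᵀ := by
    ext i j
    fin_cases i <;> simp [Matrix.mul_apply, Matrix.mulVec, dotProduct, mul_comm]
  rw [h, det_mul, det_transpose, mul_comm]

theorem adjugate_eq_transpose {O : Matrix (Fin 3) (Fin 3) ℝ} (hO : O * Oᵀ = 1)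
    (hdet : O.det = 1) : O.adjugate = Oᵀ := by
  calc O.adjugate = O.adjugate * O * Oᵀ := by rw [Matrix.mul_assoc, hO, Matrix.mul_one]
    _ = Oᵀ := by rw [adjugate_mul, hdet, one_smul, Matrix.one_mul]

theorem stmt2 (s : Fin 3 → ℝ) (T O : Matrix (Fin 3) (Fin 3) ℝ)
    (hT : T.IsSymm) (hO : O * Oᵀ = 1) (hdet : O.det = 1) :
    ((O * T * Oᵀ).det = T.det) ∧
    (((O * T * Oᵀ) * (O * T * Oᵀ)).trace = (T * T).trace) ∧
    (O.mulVec s ⬝ᵥ O.mulVec s = s ⬝ᵥ s) ∧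
    (O.mulVec s ⬝ᵥ (O * T * Oᵀ).mulVec (O.mulVec s) = s ⬝ᵥ T.mulVec s) ∧
    (I5 (O.mulVec s) (O * T * Oᵀ) = I5 s T) ∧
    (I6 (O.mulVec s) (O * T * Oᵀ) = I6 s T) := by
  have hO' : Oᵀ * O = 1 := mul_eq_one_comm.mp hO
  have conj_mulVec (A : Matrix (Fin 3) (Fin 3) ℝ) :
      (O * A * Oᵀ) *ᵥ (O *ᵥ s) = O *ᵥ (A *ᵥ s) := by
    simp only [mulVec_mulVec, Matrix.mul_assoc, hO', Matrix.mul_one]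
  have dot_mulVec (u v : Fin 3 → ℝ) : O *ᵥ u ⬝ᵥ O *ᵥ v = u ⬝ᵥ v := by
    rw [dotProduct_mulVec, ← mulVec_transpose, mulVec_mulVec, hO', one_mulVec]
  have conj_sq : (O * T * Oᵀ) * (O * T * Oᵀ) = O * (T * T) * Oᵀ := by
    calc _ = O * T * (Oᵀ * O) * T * Oᵀ := by simp only [Matrix.mul_assoc]
      _ = _ := by rw [hO', Matrix.mul_one, Matrix.mul_assoc O T T]
  have conj_adjugate : (O * T * Oᵀ).adjugate = O * T.adjugate * Oᵀ := by
    rw [adjugate_mul_distrib, adjugate_mul_distrib, ← adjugate_transpose,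
      adjugate_eq_transpose hO hdet, transpose_transpose, Matrix.mul_assoc]
  refine ⟨?_, ?_, dot_mulVec s s, ?_, ?_, ?_⟩
  · rw [det_mul, det_mul, det_transpose, hdet, one_mul, mul_one]
  · rw [conj_sq, trace_mul_comm, ← Matrix.mul_assoc, hO', Matrix.one_mul]
  · rw [conj_mulVec, dot_mulVec]
  · rw [I5_eq_adjugate, I5_eq_adjugate, conj_adjugate, conj_mulVec, dot_mulVec]
  · rw [I6, I6, sum_eps_eq_det, sum_eps_eq_det, conj_sq, conj_mulVec, conj_mulVec,
      det_of_mulVec, hdet, one_mul]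
end

section
/- Let (p_w)_{w∈W} be finitely many nonnegative reals with Σ_w p_w = 1 and let s_w ∈ ℝ³ with ‖s_w‖ ≤ 1 for each w. Put s = Σ_w p_w s_w and T = Σ_w p_w s_w s_wᵀ. Then the invariant I₅ is nonnegative: Σ_{i,j,k,l,m,n} ε_{ijk} ε_{lmn} s_i s_l T_{jm} T_{kn} ≥ 0 (in fact it equals Σ_{w,w'} p_w p_{w'} (s · (s_w × s_{w'}))², a sum of squares). -/
open Matrix

/-- The scalar triple product as a contraction with the Levi-Civita symbol. -/
lemma dotProduct_crossProduct_eq_sum_eps (u v w : Fin 3 → ℝ) :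
    u ⬝ᵥ crossProduct v w = ∑ i, ∑ j, ∑ k, eps i j k * u i * v j * w k := by
  simp [Fin.sum_univ_three, eps, cross_apply, dotProduct]
  ring

/-- The square of the scalar triple product as a contraction of two Levi-Civita symbols. -/
lemma dotProduct_crossProduct_sq_eq_sum_eps (u v w : Fin 3 → ℝ) :
    (u ⬝ᵥ crossProduct v w) ^ 2 = ∑ i, ∑ j, ∑ k, ∑ l, ∑ m, ∑ n,
      eps i j k * eps l m n * u i * u l * (v j * v m) * (w k * w n) := by
  rw [dotProduct_crossProduct_eq_sum_eps, sq]
  simp_rw [Finset.sum_mul, Finset.mul_sum]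
  refine Finset.sum_congr rfl fun i _ => Finset.sum_congr rfl fun j _ =>
    Finset.sum_congr rfl fun k _ => Finset.sum_congr rfl fun l _ =>
    Finset.sum_congr rfl fun m _ => Finset.sum_congr rfl fun n _ => ?_
  ring

/-- Contracting `ε ε s s T T` with a weighted sum of rank-one matrices `T` gives a weighted sum of
squared triple products. -/
lemma sum_eps_eq_sum_triple_product_sq {W : Type*} [Fintype W] (p : W → ℝ) (v : W → Fin 3 → ℝ)
    (s : Fin 3 → ℝ) (T : Matrix (Fin 3) (Fin 3) ℝ)
    (hT : T = ∑ w, p w • Matrix.vecMulVec (v w) (v w)) :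
    (∑ i, ∑ j, ∑ k, ∑ l, ∑ m, ∑ n, eps i j k * eps l m n * s i * s l * T j m * T k n)
      = ∑ w, ∑ w', p w * p w' * (s ⬝ᵥ crossProduct (v w) (v w')) ^ 2 := by
  have hTe (j m : Fin 3) : T j m = ∑ w, p w * (v w j * v w m) := by
    simp [hT, Matrix.sum_apply, Matrix.vecMulVec_apply]
  simp_rw [dotProduct_crossProduct_sq_eq_sum_eps, hTe, mul_assoc, Finset.sum_mul_sum,
    Finset.mul_sum,
    Finset.sum_comm (s := (Finset.univ : Finset (Fin 3))) (t := (Finset.univ : Finset W))]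
  refine Finset.sum_congr rfl fun w _ => Finset.sum_congr rfl fun w' _ =>
    Finset.sum_congr rfl fun i _ => Finset.sum_congr rfl fun j _ =>
    Finset.sum_congr rfl fun k _ => Finset.sum_congr rfl fun l _ =>
    Finset.sum_congr rfl fun m _ => Finset.sum_congr rfl fun n _ => ?_
  ring

theorem stmt4 {W : Type*} [Fintype W] (p : W → ℝ) (sw : W → Fin 3 → ℝ)
    (hp : ∀ w, 0 ≤ p w) (hsum : ∑ w, p w = 1)
    (hnorm : ∀ w, Real.sqrt (∑ i, (sw w i) ^ 2) ≤ 1)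
    (s : Fin 3 → ℝ) (hs : s = ∑ w, p w • sw w)
    (T : Matrix (Fin 3) (Fin 3) ℝ)
    (hT : T = ∑ w, p w • Matrix.vecMulVec (sw w) (sw w)) :
    (0 ≤ ∑ i, ∑ j, ∑ k, ∑ l, ∑ m, ∑ n,
        eps i j k * eps l m n * s i * s l * T j m * T k n) ∧
    (∑ i, ∑ j, ∑ k, ∑ l, ∑ m, ∑ n,
        eps i j k * eps l m n * s i * s l * T j m * T k n)
      = ∑ w, ∑ w', p w * p w' * (s ⬝ᵥ crossProduct (sw w) (sw w')) ^ 2 := by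
  have h := sum_eps_eq_sum_triple_product_sq p sw s T hT
  refine ⟨?_, h⟩
  rw [h]
  exact Finset.sum_nonneg fun w _ => Finset.sum_nonneg fun w' _ =>
    mul_nonneg (mul_nonneg (hp w) (hp w')) (sq_nonneg _)
end

section
/- Let (p_w)_{w∈W} be finitely many nonnegative reals with Σ_w p_w = 1 and let s_w ∈ ℝ³ with ‖s_w‖ ≤ 1 for each w. Put s = Σ_w p_w s_w and T = Σ_w p_w s_w s_wᵀ. Then the combination I₄ − I₃² is nonnegative: sᵀ T s − (sᵀ s)² ≥ 0. -/
open Matrix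

theorem stmt5 {W : Type*} [Fintype W] (p : W → ℝ) (sw : W → Fin 3 → ℝ)
    (hp : ∀ w, 0 ≤ p w) (hsum : ∑ w, p w = 1)
    (hnorm : ∀ w, Real.sqrt (∑ i, (sw w i) ^ 2) ≤ 1)
    (s : Fin 3 → ℝ) (hs : s = ∑ w, p w • sw w)
    (T : Matrix (Fin 3) (Fin 3) ℝ)
    (hT : T = ∑ w, p w • Matrix.vecMulVec (sw w) (sw w)) :
    0 ≤ s ⬝ᵥ T.mulVec s - (s ⬝ᵥ s) ^ 2 := by
  have hlin : s ⬝ᵥ s = ∑ w, p w * (s ⬝ᵥ sw w) := by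
    conv_lhs => arg 2; rw [hs]
    simp only [dotProduct_sum, dotProduct_smul, smul_eq_mul]
  have hquad : s ⬝ᵥ T.mulVec s = ∑ w, p w * (s ⬝ᵥ sw w) ^ 2 := by
    rw [hT, sum_mulVec, dotProduct_sum]
    refine Finset.sum_congr rfl fun w _ => ?_
    rw [smul_mulVec, dotProduct_smul, vecMulVec_mulVec, dotProduct_comm (sw w) s]
    simp only [smul_eq_mul, dotProduct_smul, op_smul_eq_smul, sq]
  rw [hlin, hquad, sub_nonneg]
  exact Real.pow_arith_mean_le_arith_mean_pow_of_even Finset.univ p _ (fun w _ => hp w) hsum even_two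
end

section
/- Let a, c, d ≥ 0 and b ∈ ℝ with a + 2c + d = 1 and a ≠ d. Set I₃ = (a−d)², I₄ = I₃(1−4c), I₅ = 8 I₃(c² − b²), and let M = !![a,0,0,c; 0,c,b,0; 0,b,c,0; c,0,0,d] be the partial transpose of the density matrix ϱ = !![a,0,0,b; 0,c,c,0; 0,c,c,0; b,0,0,d]. Then M is positive semidefinite if and only if I₄ − I₃² ≥ 0 and I₅ ≥ 0. (Equivalently: M fails to be positive semidefinite iff (a−d)² > 1 − 4c or |b| > c; the invariant conditions are necessary and sufficient for entanglement of ϱ.) -/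
open Matrix

/-- A real binary quadratic form with nonnegative diagonal and determinant is nonnegative. -/
theorem binary_form_nonneg {p q r : ℝ} (hp : 0 ≤ p) (hq : 0 ≤ q) (h : r ^ 2 ≤ p * q) (x y : ℝ) :
    0 ≤ p * x ^ 2 + 2 * r * x * y + q * y ^ 2 := by
  rcases (add_nonneg hp hq).eq_or_lt with h0 | hpos
  · obtain rfl : p = 0 := by linarith
    obtain rfl : q = 0 := by linarith
    obtain rfl : r = 0 := by nlinarith
    simp
  · refine nonneg_of_mul_nonneg_right ?_ hpos
    have key : (p + q) * (p * x ^ 2 + 2 * r * x * y + q * y ^ 2) =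
        (p * x + r * y) ^ 2 + (r * x + q * y) ^ 2 + (p * q - r ^ 2) * (x ^ 2 + y ^ 2) := by ring
    have := sub_nonneg.2 h
    rw [key]
    positivity

/-- The X-shaped matrix below, with nonnegative diagonal, is positive semidefinite iff its
outer and inner `2 × 2` blocks have nonnegative determinant. -/
theorem posSemidef_xShaped_iff {a b c d : ℝ} (ha : 0 ≤ a) (hc : 0 ≤ c) (hd : 0 ≤ d) :
    (!![a, 0, 0, c; 0, c, b, 0; 0, b, c, 0; c, 0, 0, d] : Matrix (Fin 4) (Fin 4) ℝ).PosSemidef ↔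
      c ^ 2 ≤ a * d ∧ b ^ 2 ≤ c ^ 2 := by
  constructor
  · intro h
    have outer := (h.submatrix ![0, 3]).det_nonneg
    have inner := (h.submatrix ![1, 2]).det_nonneg
    rw [det_fin_two] at outer inner
    simp at outer inner
    constructor <;> linarith
  · rintro ⟨hout, hin⟩
    refine PosSemidef.of_dotProduct_mulVec_nonneg ?_ fun x => ?_
    · ext i j
      fin_cases i <;> fin_cases j <;> simp
    · have outer := binary_form_nonneg ha hd hout (x 0) (x 3)
      have inner := binary_form_nonneg hc hc (hin.trans_eq (sq c)) (x 1) (x 2)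
      simp [dotProduct, mulVec, Fin.sum_univ_four]
      linarith

theorem stmt9 (a b c d : ℝ) (ha : 0 ≤ a) (hc : 0 ≤ c) (hd : 0 ≤ d)
    (htr : a + 2 * c + d = 1) (had : a ≠ d)
    (I₃ I₄ I₅ : ℝ) (hI₃ : I₃ = (a - d) ^ 2) (hI₄ : I₄ = I₃ * (1 - 4 * c))
    (hI₅ : I₅ = 8 * I₃ * (c ^ 2 - b ^ 2))
    (M : Matrix (Fin 4) (Fin 4) ℝ)
    (hM : M = !![a, 0, 0, c; 0, c, b, 0; 0, b, c, 0; c, 0, 0, d]) :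
    M.PosSemidef ↔ (0 ≤ I₄ - I₃ ^ 2 ∧ 0 ≤ I₅) := by
  have hpos : 0 < I₃ := hI₃ ▸ sq_pos_of_ne_zero (sub_ne_zero.2 had)
  have h₄ : I₄ - I₃ ^ 2 = 4 * I₃ * (a * d - c ^ 2) := by
    obtain rfl : a = 1 - 2 * c - d := by linarith
    rw [hI₄, hI₃]
    ring
  rw [hM, posSemidef_xShaped_iff ha hc hd, h₄, hI₅, mul_nonneg_iff_of_pos_left (by positivity),
    mul_nonneg_iff_of_pos_left (by positivity), sub_nonneg, sub_nonneg]
end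

section
/- Let t⁺, t⁻, t₃ be real numbers with t⁻ ≤ t⁺, t⁺ + t⁻ + t₃ = 1, and t⁺, t⁻, t₃ ∈ [−1, 1]; let s₀ be a nonzero real and N ≥ 2 a natural number. Define I₅ = 2 s₀² t⁺ t⁻ and the spin squeezing parameter by ξ² = 1 + (N−1) t⁻. Then I₅ < 0 if and only if ξ² < 1. (A symmetric multiqubit state is spin squeezed if and only if the invariant I₅ is negative.) -/
theorem stmt10 (tp tm t₃ s₀ : ℝ) (N : ℕ)
    (hord : tm ≤ tp) (hsum : tp + tm + t₃ = 1)
    (htp : tp ∈ Set.Icc (-1 : ℝ) 1) (htm : tm ∈ Set.Icc (-1 : ℝ) 1)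
    (ht₃ : t₃ ∈ Set.Icc (-1 : ℝ) 1)
    (hs₀ : s₀ ≠ 0) (hN : 2 ≤ N)
    (I₅ ξsq : ℝ) (hI₅ : I₅ = 2 * s₀ ^ 2 * tp * tm)
    (hξ : ξsq = 1 + ((N : ℝ) - 1) * tm) :
    I₅ < 0 ↔ ξsq < 1 := by
  have hs : 0 < 2 * s₀ ^ 2 := by positivity
  have hN' : (0 : ℝ) < (N : ℝ) - 1 := by
    have : (2 : ℝ) ≤ N := by exact_mod_cast hN
    linarith
  have hadd : 0 ≤ tp + tm := by linarith [ht₃.2]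
  subst hI₅ hξ
  constructor
  · intro h
    have htm_neg : tm < 0 := by
      by_contra! hnonneg
      have : 0 ≤ 2 * s₀ ^ 2 * tp * tm :=
        mul_nonneg (mul_nonneg hs.le (hnonneg.trans hord)) hnonneg
      linarith
    linarith [mul_neg_of_pos_of_neg hN' htm_neg]
  · intro h
    have htm_neg : tm < 0 := by
      by_contra! hnonneg
      linarith [mul_nonneg hN'.le hnonneg]
    exact mul_neg_of_pos_of_neg (mul_pos hs (by linarith)) htm_neg
end

section
/- Let T be a 3×3 real symmetric matrix and s ∈ ℝ³. Then Σ_{i,j,k,l,m,n} ε_{ijk} ε_{lmn} s_i s_l T_{jm} T_{kn} = 2 sᵀ (adjugate T) s, and consequently det(T − s sᵀ) = det T − (1/2) Σ_{i,j,k,l,m,n} ε_{ijk} ε_{lmn} s_i s_l T_{jm} T_{kn}; i.e. the invariant Ī₁ = det(T − ssᵀ) of the covariance-matrix block equals I₁ − I₅/2. -/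
open Matrix

/-- Contraction with the Levi-Civita symbol is the signed sum over the permutations of `Fin 3`. -/
theorem sum_eps_mul (f : Fin 3 → Fin 3 → Fin 3 → ℝ) :
    ∑ i, ∑ j, ∑ k, eps i j k * f i j k =
      f 0 1 2 - f 0 2 1 - f 1 0 2 + f 1 2 0 + f 2 0 1 - f 2 1 0 := by
  simp only [Fin.sum_univ_three, eps, Fin.val_zero, Fin.val_one, Fin.val_two]
  push_cast
  ring

/-- The double Levi-Civita contraction of `s`, `s`, `T`, `T` is twice the quadratic form of the
adjugate of `T`. -/
theorem sum_eps_mul_eps_eq_two_mul_adjugate (s : Fin 3 → ℝ) (T : Matrix (Fin 3) (Fin 3) ℝ) :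
    ∑ i, ∑ j, ∑ k, ∑ l, ∑ m, ∑ n, eps i j k * eps l m n * s i * s l * T j m * T k n =
      2 * (s ⬝ᵥ T.adjugate.mulVec s) := by
  have factor : ∀ i j k,
      ∑ l, ∑ m, ∑ n, eps i j k * eps l m n * s i * s l * T j m * T k n =
        eps i j k * ∑ l, ∑ m, ∑ n, eps l m n * (s i * s l * T j m * T k n) := by
    intro i j k
    simp only [Finset.mul_sum, mul_assoc]
  simp only [factor, sum_eps_mul]
  simp [Matrix.adjugate_fin_three, dotProduct, Matrix.mulVec, Fin.sum_univ_three]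
  ring

/-- The matrix determinant lemma for a rank-one downdate of a `3 × 3` matrix. -/
theorem det_sub_vecMulVec_fin_three (s : Fin 3 → ℝ) (T : Matrix (Fin 3) (Fin 3) ℝ) :
    (T - Matrix.vecMulVec s s).det = T.det - s ⬝ᵥ T.adjugate.mulVec s := by
  simp [Matrix.det_fin_three, Matrix.adjugate_fin_three, dotProduct, Matrix.mulVec,
    Matrix.vecMulVec_apply, Fin.sum_univ_three]
  ring

theorem stmt12 (s : Fin 3 → ℝ) (T : Matrix (Fin 3) (Fin 3) ℝ) (hT : T.IsSymm) :
    ((∑ i, ∑ j, ∑ k, ∑ l, ∑ m, ∑ n,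
        eps i j k * eps l m n * s i * s l * T j m * T k n)
      = 2 * (s ⬝ᵥ T.adjugate.mulVec s)) ∧
    ((T - Matrix.vecMulVec s s).det
      = T.det - (1 / 2) * ∑ i, ∑ j, ∑ k, ∑ l, ∑ m, ∑ n,
          eps i j k * eps l m n * s i * s l * T j m * T k n) := by
  refine ⟨sum_eps_mul_eps_eq_two_mul_adjugate s T, ?_⟩
  rw [sum_eps_mul_eps_eq_two_mul_adjugate, det_sub_vecMulVec_fin_three]
  ring
end

section
/- Let ρ be a Hermitian positive semidefinite 4×4 complex matrix of trace 1 (indexed by Fin 2 × Fin 2) satisfying Πρ = ρ, where Π is the swap operator. Let s ∈ ℝ³ and the 3×3 real matrix T be its Bloch vector and correlation matrix, and let ρ^{T₂} be the partial transpose of ρ with respect to the second factor. Then ρ^{T₂} is positive semidefinite if and only if the 3×3 real symmetric matrix C = T − s sᵀ is positive semidefinite. (Negativity of C is necessary and sufficient for entanglement of a symmetric two-qubit state.) -/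
open Matrix Kronecker Complex ComplexOrder

noncomputable def pauli : Fin 3 → Matrix (Fin 2) (Fin 2) ℂ :=
  ![!![0, 1; 1, 0], !![0, -I; I, 0], !![1, 0; 0, -1]]

/-- The swap operator on two qubits: `Π_{(i,j),(k,l)} = δ_{il} δ_{jk}`. -/
def swapOp : Matrix (Fin 2 × Fin 2) (Fin 2 × Fin 2) ℂ :=
  Matrix.of fun p q => if p.1 = q.2 ∧ p.2 = q.1 then 1 else 0

/-- The operator basis `1, σ₁, σ₂, σ₃`. -/
noncomputable def pauliBasis : Unit ⊕ Fin 3 → Matrix (Fin 2) (Fin 2) ℂ :=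
  Sum.elim (fun _ => 1) pauli

/-- The vectorized operators `1, σ₁, σ₂, σ₃`, as columns. -/
noncomputable def pauliVec : Matrix (Fin 2 × Fin 2) (Unit ⊕ Fin 3) ℂ :=
  Matrix.of fun p a => pauliBasis a p.1 p.2

lemma pauliBasis_isHermitian (a : Unit ⊕ Fin 3) : (pauliBasis a).IsHermitian := by
  rcases a with _ | i
  · exact Matrix.isHermitian_one
  · ext m n
    fin_cases i <;> fin_cases m <;> fin_cases n <;> simp [pauliBasis, pauli]

lemma pauliVec_mul_conjTranspose : pauliVec * pauliVecᴴ = (2 : ℂ) • 1 := by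
  ext ⟨i, j⟩ ⟨k, l⟩
  fin_cases i <;> fin_cases j <;> fin_cases k <;> fin_cases l <;>
    simp [Matrix.mul_apply, pauliVec, pauliBasis, pauli, Fin.sum_univ_three] <;>
    norm_num

lemma Matrix.IsHermitian.ofReal_re_trace_mul {n : Type*} [Fintype n] {A B : Matrix n n ℂ}
    (hA : A.IsHermitian) (hB : B.IsHermitian) : (((A * B).trace.re : ℝ) : ℂ) = (A * B).trace := by
  rw [← Complex.conj_eq_iff_re, ← Complex.star_def, ← Matrix.trace_conjTranspose,
    Matrix.conjTranspose_mul, hA.eq, hB.eq, Matrix.trace_mul_comm]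

open scoped MatrixOrder in
lemma Matrix.posSemidef_map_ofReal_iff {n : Type*} [Finite n] {A : Matrix n n ℝ} :
    (A.map ((↑) : ℝ → ℂ)).PosSemidef ↔ A.PosSemidef := by
  have := Fintype.ofFinite n
  classical
  constructor
  · intro h
    refine .of_dotProduct_mulVec_nonneg ?_ fun x => ?_
    · ext i j
      have := h.1.apply i j
      simpa using this
    · have := h.dotProduct_mulVec_nonneg (fun i => (x i : ℂ))
      rw [← Complex.zero_le_real]
      simpa [Matrix.mulVec, dotProduct] using this
  · intro h
    obtain ⟨B, rfl⟩ := CStarAlgebra.nonneg_iff_eq_star_mul_self.mp h.nonneg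
    convert Matrix.posSemidef_conjTranspose_mul_self (B.map ((↑) : ℝ → ℂ)) using 1
    ext i j
    simp [Matrix.mul_apply, Matrix.star_eq_conjTranspose]

lemma swap_apply_left {ρ : Matrix (Fin 2 × Fin 2) (Fin 2 × Fin 2) ℂ} (hsym : swapOp * ρ = ρ)
    (i j : Fin 2) (q : Fin 2 × Fin 2) : ρ (j, i) q = ρ (i, j) q := by
  conv_rhs => rw [← hsym]
  fin_cases i <;> fin_cases j <;> simp [Matrix.mul_apply, swapOp, Fintype.sum_prod_type]

lemma swap_apply_right {ρ : Matrix (Fin 2 × Fin 2) (Fin 2 × Fin 2) ℂ} (hherm : ρ.IsHermitian)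
    (hsym : swapOp * ρ = ρ) (p : Fin 2 × Fin 2) (i j : Fin 2) : ρ p (j, i) = ρ p (i, j) := by
  rw [← hherm.apply, swap_apply_left hsym, hherm.apply]

lemma trace_mul_kronecker_comm {ρ : Matrix (Fin 2 × Fin 2) (Fin 2 × Fin 2) ℂ}
    (hherm : ρ.IsHermitian) (hsym : swapOp * ρ = ρ) (A B : Matrix (Fin 2) (Fin 2) ℂ) :
    (ρ * (A ⊗ₖ B)).trace = (ρ * (B ⊗ₖ A)).trace := by
  have h₁ := swap_apply_left hsym 0 1
  have h₂ := fun p => swap_apply_right hherm hsym p 0 1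
  simp [Matrix.trace, Matrix.mul_apply, Fintype.sum_prod_type, h₁, h₂]
  ring

/-- In the vectorized Pauli basis the partial transpose is the matrix of Pauli expectations. -/
lemma conjTranspose_pauliVec_mul_partialTranspose_mul
    {ρ : Matrix (Fin 2 × Fin 2) (Fin 2 × Fin 2) ℂ}
    (hherm : ρ.IsHermitian) (hsym : swapOp * ρ = ρ) (a b : Unit ⊕ Fin 3) :
    (pauliVecᴴ * (Matrix.of fun p q => ρ (p.1, q.2) (q.1, p.2) :
      Matrix (Fin 2 × Fin 2) (Fin 2 × Fin 2) ℂ) * pauliVec) a b =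
      (ρ * (pauliBasis a ⊗ₖ pauliBasis b)).trace := by
  have h₁ := swap_apply_left hsym 0 1
  have h₂ := fun p => swap_apply_right hherm hsym p 0 1
  have h₃ := fun i j => (pauliBasis_isHermitian a).apply i j
  simp only [RCLike.star_def] at h₃
  simp [Matrix.trace, Matrix.mul_apply, Fintype.sum_prod_type, h₁, h₂, pauliVec, h₃]
  ring

theorem stmt15 (ρ : Matrix (Fin 2 × Fin 2) (Fin 2 × Fin 2) ℂ)
    (hherm : ρ.IsHermitian) (hpsd : ρ.PosSemidef) (htr : ρ.trace = 1)
    (hsym : swapOp * ρ = ρ)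
    (s : Fin 3 → ℝ)
    (hs : s = fun i =>
      ((ρ * (pauli i ⊗ₖ (1 : Matrix (Fin 2) (Fin 2) ℂ))).trace).re)
    (T : Matrix (Fin 3) (Fin 3) ℝ)
    (hT : T = Matrix.of fun i j => ((ρ * (pauli i ⊗ₖ pauli j)).trace).re)
    (ρPT : Matrix (Fin 2 × Fin 2) (Fin 2 × Fin 2) ℂ)
    (hPT : ρPT = Matrix.of fun p q => ρ (p.1, q.2) (q.1, p.2)) :
    ρPT.PosSemidef ↔ (T - Matrix.vecMulVec s s).PosSemidef := by
  have hre (a b : Unit ⊕ Fin 3) :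
      (((ρ * (pauliBasis a ⊗ₖ pauliBasis b)).trace.re : ℝ) : ℂ) =
        (ρ * (pauliBasis a ⊗ₖ pauliBasis b)).trace :=
    hherm.ofReal_re_trace_mul <| by
      rw [Matrix.IsHermitian, Matrix.conjTranspose_kronecker,
        (pauliBasis_isHermitian a).eq, (pauliBasis_isHermitian b).eq]
  have hblocks : pauliVecᴴ * ρPT * pauliVec =
      (Matrix.fromBlocks 1 (Matrix.replicateRow Unit s) (Matrix.replicateRow Unit s)ᴴ T).map
        ((↑) : ℝ → ℂ) := by
    ext a b
    rw [hPT, conjTranspose_pauliVec_mul_partialTranspose_mul hherm hsym]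
    rcases a with _ | i <;> rcases b with _ | j
    · simp [pauliBasis, htr]
    · rw [trace_mul_kronecker_comm hherm hsym, ← hre]
      simp [pauliBasis, hs]
    · rw [← hre]
      simp [pauliBasis, hs]
    · rw [← hre]
      simp [pauliBasis, hT]
  have hconj : (pauliVecᴴ * ρPT * pauliVec).PosSemidef ↔ ρPT.PosSemidef := by
    refine ⟨fun h => ?_, fun h => h.conjTranspose_mul_mul_same pauliVec⟩
    have h' := (h.mul_mul_conjTranspose_same pauliVec).smul (show (0 : ℝ) ≤ 1 / 4 by norm_num)
    convert h' using 1
    have : pauliVec * (pauliVecᴴ * ρPT * pauliVec) * pauliVecᴴ =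
        (pauliVec * pauliVecᴴ) * ρPT * (pauliVec * pauliVecᴴ) := by
      simp only [Matrix.mul_assoc]
    rw [this, pauliVec_mul_conjTranspose]
    ext p q
    simp
    ring
  let : Invertible (1 : Matrix Unit Unit ℝ) := invertibleOne
  rw [← hconj, hblocks, Matrix.posSemidef_map_ofReal_iff,
    Matrix.PosDef.fromBlocks₁₁ _ _ Matrix.PosDef.one]
  congr! 2
  ext i j
  simp [Matrix.mul_apply, Matrix.vecMulVec_apply]
end
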